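/- arXiv:2406.04497 — 5 statements merged into one kernel-verified Lean document; each statement's English description precedes it below -/
import Mathlib

section
/- If an adversary A on a finite nonempty type V of processes is knot opaque, then no knot-identification algorithm solves the Knot Identification Problem on A. -/
/-- Local observation graph `LG σ i p` of process `p` at state `i` in computation `σ`:
`LG σ 0 p = {(q,p,0) | σ 0 q p}` and
`LG σ (i+1) p = LG σ i p ∪ ⋃_{q : σ (i+1) q p} (LG σ i q ∪ {(q,p,i+1)})`. -/
def LG {V : Type*} (σ : ℕ → V → V → Prop) : ℕ → V → Set (V × V × ℕ)
  | 0, p => {x | ∃ q, σ 0 q p ∧ x = (q, p, 0)}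
  | (i+1), p =>
      LG σ i p ∪ {x | ∃ q, σ (i+1) q p ∧ (x ∈ LG σ i q ∨ x = (q, p, i+1))}

/-- The digraph of a set of link events: `(u,v)` is an edge iff `(u,v,t)` occurs for some `t`. -/
def digraph {V : Type*} (E : Set (V × V × ℕ)) : V → V → Prop :=
  fun u v => ∃ t, (u, v, t) ∈ E

/-- `K` is a knot of the directed graph `r`: `K` has at least two elements, any two
vertices of `K` are joined by a directed `r`-path staying inside `K`, and there is
no edge `r u w` with `u ∉ K` and `w ∈ K`. -/
def IsKnot {V : Type*} (r : V → V → Prop) (K : Set V) : Prop :=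
  K.Nontrivial ∧
  (∀ u ∈ K, ∀ w ∈ K,
    Relation.ReflTransGen (fun a b => r a b ∧ a ∈ K ∧ b ∈ K) u w) ∧
  (∀ u w, r u w → u ∉ K → w ∉ K)

/-- Process `p` observes knot `K` by state `i` in computation `σ`. -/
def ObservesBy {V : Type*} (σ : ℕ → V → V → Prop) (p : V) (K : Set V) (i : ℕ) : Prop :=
  ∃ j ≤ i, IsKnot (digraph (LG σ j p)) K

/-- `K` is globally observable in `σ`: every process observes `K` by some state. -/
def GloballyObservable {V : Type*} (σ : ℕ → V → V → Prop) (K : Set V) : Prop :=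
  ∀ p, ∃ i, ObservesBy σ p K i

/-- `σ₁` and `σ₂` are observation identical for `p` up to state `i`. -/
def ObsIdentical {V : Type*} (σ₁ σ₂ : ℕ → V → V → Prop) (p : V) (i : ℕ) : Prop :=
  ∀ j ≤ i, LG σ₁ j p = LG σ₂ j p

/-- A knot-identification algorithm: deterministic on local observation graphs
and only outputting observed knots. -/
structure KIAlg (V : Type*) where
  S : V → (ℕ → V → V → Prop) → ℕ → Option (Set V)
  det : ∀ p σ₁ σ₂ i, ObsIdentical σ₁ σ₂ p i → ∀ j ≤ i, S p σ₁ j = S p σ₂ j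
  observed : ∀ p σ i K, S p σ i = some K → ObservesBy σ p K i

/-- `alg` solves the Knot Identification Problem on adversary `A`:
Termination and Agreement on every computation of `A`. -/
def SolvesKI {V : Type*} (A : Set (ℕ → V → V → Prop)) (alg : KIAlg V) : Prop :=
  ∀ σ ∈ A,
    (∀ p : V, ∃ i K, alg.S p σ i = some K) ∧
    (∀ p q i j K K', alg.S p σ i = some K → alg.S q σ j = some K' → K = K')

/-- `A` is knot opaque. -/
def KnotOpaque {V : Type*} (A : Set (ℕ → V → V → Prop)) : Prop :=
  ∃ p : V, ∃ σ₁ ∈ A, ∀ i K, ObservesBy σ₁ p K i →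
    ∃ σ₂ ∈ A, ObsIdentical σ₁ σ₂ p i ∧ ¬ GloballyObservable σ₂ K

/-- Insertion of a non-communicating state after position `k`. -/
def insertNC {V : Type*} (σ : ℕ → V → V → Prop) (k : ℕ) : ℕ → V → V → Prop :=
  fun t => if t ≤ k then σ t else if t = k + 1 then (fun _ _ => False) else σ (t - 1)

/-- `A` is asynchronous: closed under insertion of non-communicating states. -/
def Asynchronous {V : Type*} (A : Set (ℕ → V → V → Prop)) : Prop :=
  ∀ σ ∈ A, ∀ k : ℕ, insertNC σ k ∈ A

/-- `A` is knot observation final. -/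
def KnotObsFinal {V : Type*} (A : Set (ℕ → V → V → Prop)) : Prop :=
  ∀ σ₁ ∈ A, ∀ (p : V) (i : ℕ), ∃ σ₂ ∈ A, ObsIdentical σ₁ σ₂ p i ∧
    ∀ K : Set V, (∃ j, ObservesBy σ₂ p K j) → ObservesBy σ₂ p K i

/-- `K` is primary for `p` in `σ`: `p` observes `K` by the least state by which
`p` observes any knot. -/
def Primary {V : Type*} (σ : ℕ → V → V → Prop) (p : V) (K : Set V) : Prop :=
  ∃ i, ObservesBy σ p K i ∧ ∀ j, (∃ K' : Set V, ObservesBy σ p K' j) → i ≤ j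

/-- `A` is primary uniform: in every computation every process observes a knot,
and all primary knots coincide. -/
def PrimaryUniform {V : Type*} (A : Set (ℕ → V → V → Prop)) : Prop :=
  ∀ σ ∈ A,
    (∀ p : V, ∃ (K : Set V) (i : ℕ), ObservesBy σ p K i) ∧
    (∀ (p₁ p₂ : V) (K₁ K₂ : Set V), Primary σ p₁ K₁ → Primary σ p₂ K₂ → K₁ = K₂)

/-- If an adversary on a finite nonempty type of processes is knot opaque, then no
knot-identification algorithm solves the Knot Identification Problem on it. -/
theorem no_solution_of_knotOpaque {V : Type*} [Fintype V] [Nonempty V]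
    (A : Set (ℕ → V → V → Prop)) (hOpaque : KnotOpaque A) :
    ¬ ∃ alg : KIAlg V, SolvesKI A alg := by
  rintro ⟨alg, hSolves⟩
  obtain ⟨p, σ₁, hσ₁, hp⟩ := hOpaque
  obtain ⟨i, K, hK⟩ := (hSolves σ₁ hσ₁).1 p
  obtain ⟨σ₂, hσ₂, hId, hNot⟩ := hp i K (alg.observed p σ₁ i K hK)
  have hK₂ : alg.S p σ₂ i = some K := by
    rw [← alg.det p σ₁ σ₂ i hId i le_rfl, hK]
  refine hNot fun q => ?_
  obtain ⟨j, K', hK'⟩ := (hSolves σ₂ hσ₂).1 q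
  obtain rfl := (hSolves σ₂ hσ₂).2 p q i j K K' hK₂ hK'
  exact ⟨j, alg.observed q σ₂ j K hK'⟩
end

section
/- If an adversary A on a finite nonempty type V of processes is primary uniform, then there exists a knot-identification algorithm that solves the Knot Identification Problem on A. -/
/-- `K` is a knot of the first local observation graph of `p` that has a knot, and that graph
is reached by state `i`. -/
def FirstKnotBy {V : Type*} (p : V) (σ : ℕ → V → V → Prop) (i : ℕ) (K : Set V) : Prop :=
  ∃ j ≤ i, IsKnot (digraph (LG σ j p)) K ∧ ∀ m < j, ∀ K', ¬ IsKnot (digraph (LG σ m p)) K'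

namespace FirstKnotBy

variable {V : Type*} {p : V} {σ σ₁ σ₂ : ℕ → V → V → Prop} {i j : ℕ} {K : Set V}

theorem observesBy (h : FirstKnotBy p σ i K) : ObservesBy σ p K i :=
  let ⟨j, hj, hK, _⟩ := h
  ⟨j, hj, hK⟩

theorem primary (h : FirstKnotBy p σ i K) : Primary σ p K := by
  obtain ⟨j, -, hK, hmin⟩ := h
  refine ⟨j, ⟨j, le_rfl, hK⟩, ?_⟩
  rintro l ⟨K', m, hml, hK'⟩
  by_contra! hlj
  exact hmin m (hml.trans_lt hlj) K' hK'

theorem of_obsIdentical (hid : ObsIdentical σ₁ σ₂ p i) (hj : j ≤ i)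
    (h : FirstKnotBy p σ₁ j K) : FirstKnotBy p σ₂ j K := by
  obtain ⟨l, hl, hK, hmin⟩ := h
  refine ⟨l, hl, hid l (hl.trans hj) ▸ hK, fun m hm => ?_⟩
  rw [← hid m (hm.le.trans (hl.trans hj))]
  exact hmin m hm

theorem exists_of_observesBy (h : ObservesBy σ p K i) : ∃ K', FirstKnotBy p σ i K' := by
  classical
  obtain ⟨j, hj, hK⟩ := h
  have hex : ∃ j, ∃ K', IsKnot (digraph (LG σ j p)) K' := ⟨j, K, hK⟩
  obtain ⟨K', hK'⟩ := Nat.find_spec hex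
  exact ⟨K', Nat.find hex, (Nat.find_min' hex ⟨K, hK⟩).trans hj, hK',
    fun m hm K'' hK'' => Nat.find_min hex hm ⟨K'', hK''⟩⟩

end FirstKnotBy

open Classical in
/-- Some element satisfying `P`, if there is one. -/
noncomputable def chooseOption {α : Type*} (P : α → Prop) : Option α :=
  if h : ∃ a, P a then some h.choose else none

theorem of_chooseOption_eq_some {α : Type*} {P : α → Prop} {a : α}
    (h : chooseOption P = some a) : P a := by
  unfold chooseOption at h
  split_ifs at h with hex
  exact Option.some.inj h ▸ hex.choose_spec

theorem exists_chooseOption_eq_some {α : Type*} {P : α → Prop} (h : ∃ a, P a) :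
    ∃ a, chooseOption P = some a :=
  ⟨h.choose, dif_pos h⟩

/-- The algorithm by which each process outputs a knot it observes first. -/
noncomputable def firstKnotAlg (V : Type*) : KIAlg V where
  S p σ i := chooseOption (FirstKnotBy p σ i)
  det p σ₁ σ₂ i hid j hj := by
    refine congrArg chooseOption (funext fun K => propext ?_)
    exact ⟨.of_obsIdentical hid hj, .of_obsIdentical (fun k hk => (hid k hk).symm) hj⟩
  observed _ _ _ _ h := (of_chooseOption_eq_some h).observesBy

/-- If an adversary is primary uniform, then some knot-identification algorithm solves
the Knot Identification Problem on it. -/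
theorem solution_of_primaryUniform {V : Type*} [Fintype V] [Nonempty V]
    (A : Set (ℕ → V → V → Prop)) (hUnif : PrimaryUniform A) :
    ∃ alg : KIAlg V, SolvesKI A alg := by
  refine ⟨firstKnotAlg V, fun σ hσ => ⟨fun p => ?_, fun p q i j K K' hK hK' => ?_⟩⟩
  · obtain ⟨K, i, hK⟩ := (hUnif σ hσ).1 p
    exact ⟨i, exists_chooseOption_eq_some (FirstKnotBy.exists_of_observesBy hK)⟩
  · exact (hUnif σ hσ).2 p q K K' (of_chooseOption_eq_some hK).primary
      (of_chooseOption_eq_some hK').primary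
end

section
/- Let V be a finite nonempty linearly ordered type of processes and A an adversary on V. If there exists a knot-identification algorithm that solves the Knot Identification Problem on A, then there exists a consensus algorithm that solves Consensus on A (i.e., a knot-identification adversary is also a consensual adversary). -/
/-- A consensus algorithm: each process's output up to state `i` depends only on its
local observation graph up to `i`, its own input, and the inputs of processes incident
to link events of its local observation graph. -/
structure ConsAlg (V : Type*) where
  C : V → (V → Bool) → (ℕ → V → V → Prop) → ℕ → Option Bool
  det : ∀ (p : V) (x₁ x₂ : V → Bool) σ₁ σ₂ (i : ℕ),
    ObsIdentical σ₁ σ₂ p i →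
    x₁ p = x₂ p →
    (∀ u v : V, ∀ t : ℕ, (u, v, t) ∈ LG σ₁ i p → x₁ u = x₂ u ∧ x₁ v = x₂ v) →
    ∀ j ≤ i, C p x₁ σ₁ j = C p x₂ σ₂ j

/-- `alg` solves Consensus on adversary `A`: Termination, Agreement and Validity
hold on every computation of `A` and every input assignment. -/
def SolvesConsensus {V : Type*} (A : Set (ℕ → V → V → Prop)) (alg : ConsAlg V) : Prop :=
  ∀ σ ∈ A, ∀ x : V → Bool,
    (∀ p : V, ∃ (i : ℕ) (v : Bool), alg.C p x σ i = some v) ∧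
    (∀ (p q : V) (i j : ℕ) (v v' : Bool),
      alg.C p x σ i = some v → alg.C q x σ j = some v' → v = v') ∧
    (∀ v : Bool, (∀ p, x p = v) →
      ∀ (p : V) (i : ℕ) (v' : Bool), alg.C p x σ i = some v' → v' = v)

theorem LG_mono {V : Type*} (σ : ℕ → V → V → Prop) (p : V) : Monotone fun i => LG σ i p :=
  monotone_nat_of_le_succ fun _ _ hx => Or.inl hx

/-- Every vertex of a knot has an outgoing edge. -/
theorem IsKnot.exists_edge {V : Type*} {r : V → V → Prop} {K : Set V} (h : IsKnot r K)
    {u : V} (hu : u ∈ K) : ∃ w, r u w := by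
  obtain ⟨w, hw, hne⟩ := h.1.exists_ne u
  rcases (h.2.1 u hu w hw).cases_head with rfl | ⟨c, hc, _⟩
  · exact absurd rfl hne
  · exact ⟨c, hc.1⟩

/-- Every vertex of a knot observed by `p` is the source of a link event observed by `p`. -/
theorem ObservesBy.exists_link {V : Type*} {σ : ℕ → V → V → Prop} {p : V} {K : Set V} {i : ℕ}
    (h : ObservesBy σ p K i) {u : V} (hu : u ∈ K) : ∃ v t, (u, v, t) ∈ LG σ i p := by
  obtain ⟨j, hj, hK⟩ := h
  obtain ⟨v, t, ht⟩ := hK.exists_edge hu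
  exact ⟨v, t, LG_mono σ p hj ht⟩

/-- The consensus algorithm deciding the input of a distinguished process of the identified
knot. -/
noncomputable def KIAlg.toConsAlg {V : Type*} [Nonempty V] (alg : KIAlg V) : ConsAlg V where
  C p x σ i := (alg.S p σ i).map fun K => x (Classical.epsilon (· ∈ K))
  det p x₁ x₂ σ₁ σ₂ i hobs _ hx j hj := by
    rw [← alg.det p σ₁ σ₂ i hobs j hj]
    refine Option.map_congr fun K hK => ?_
    have hO := alg.observed p σ₁ j K hK
    have hne : K.Nonempty := let ⟨_, _, h⟩ := hO; h.1.nonempty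
    obtain ⟨v, t, ht⟩ := hO.exists_link (Classical.epsilon_spec hne)
    exact (hx _ v t (LG_mono σ₁ p hj ht)).1

/-- A knot-identification adversary is also a consensual adversary. -/
theorem consensual_of_knot_identification {V : Type*} [Fintype V] [Nonempty V]
    [LinearOrder V] (A : Set (ℕ → V → V → Prop))
    (hKI : ∃ alg : KIAlg V, SolvesKI A alg) :
    ∃ calg : ConsAlg V, SolvesConsensus A calg := by
  obtain ⟨alg, h⟩ := hKI
  refine ⟨alg.toConsAlg, fun σ hσ x => ⟨fun p => ?_, fun p q i j v v' hv hv' => ?_,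
    fun v hx p i v' hv' => ?_⟩⟩
  · obtain ⟨i, K, hK⟩ := (h σ hσ).1 p
    exact ⟨i, _, Option.map_eq_some_iff.2 ⟨K, hK, rfl⟩⟩
  · obtain ⟨K, hK, rfl⟩ := Option.map_eq_some_iff.1 hv
    obtain ⟨K', hK', rfl⟩ := Option.map_eq_some_iff.1 hv'
    rw [(h σ hσ).2 p q i j K K' hK hK']
  · obtain ⟨K, _, rfl⟩ := Option.map_eq_some_iff.1 hv'
    exact hx _
end

section
/- Insertion of a non-communicating state preserves all causal (local observation) information: let σ be a computation on a finite nonempty type V of processes, k ∈ ℕ, and let σ' be the computation with σ' t = σ t for t ≤ k, σ' (k+1) u v = False for all u, v, and σ' t = σ (t−1) for t ≥ k+2. Let φ : V × V × ℕ → V × V × ℕ map (u,v,t) to (u,v,t) if t ≤ k and to (u,v,t+1) if t > k. Then for every process p: LG(p,σ',i) = LG(p,σ,i) for all i ≤ k, and LG(p,σ',i) = φ '' LG(p,σ,i−1) (the image of LG(p,σ,i−1) under φ) for all i ≥ k+1. -/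
theorem LG_succ {V : Type*} (σ : ℕ → V → V → Prop) (i : ℕ) (p : V) :
    LG σ (i + 1) p =
      LG σ i p ∪ {x | ∃ q, σ (i + 1) q p ∧ (x ∈ LG σ i q ∨ x = (q, p, i + 1))} :=
  rfl

theorem time_le_of_mem_LG {V : Type*} {σ : ℕ → V → V → Prop} {i : ℕ} {p : V}
    {x : V × V × ℕ} (hx : x ∈ LG σ i p) : x.2.2 ≤ i := by
  induction i generalizing p with
  | zero =>
    obtain ⟨q, -, rfl⟩ := hx
    exact le_rfl
  | succ i ih =>
    rcases hx with hx | ⟨q, -, hx | rfl⟩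
    · exact (ih hx).trans i.le_succ
    · exact (ih hx).trans i.le_succ
    · exact le_rfl

theorem LG_congr {V : Type*} {σ τ : ℕ → V → V → Prop} {i : ℕ}
    (h : ∀ t ≤ i, σ t = τ t) (p : V) : LG σ i p = LG τ i p := by
  induction i generalizing p with
  | zero => simp only [LG, h 0 le_rfl]
  | succ i ih =>
    simp only [LG, h (i + 1) le_rfl, ih fun t ht => h t (ht.trans i.le_succ)]

theorem insertNC_of_le {V : Type*} (σ : ℕ → V → V → Prop) {k t : ℕ} (h : t ≤ k) :
    insertNC σ k t = σ t :=
  if_pos h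

theorem insertNC_succ_self {V : Type*} (σ : ℕ → V → V → Prop) (k : ℕ) :
    insertNC σ k (k + 1) = fun _ _ => False := by
  simp [insertNC]

theorem insertNC_succ_of_lt {V : Type*} (σ : ℕ → V → V → Prop) {k t : ℕ} (h : k < t) :
    insertNC σ k (t + 1) = σ t := by
  simp [insertNC, show ¬ t + 1 ≤ k by omega, h.ne']

theorem LG_succ_of_not_communicating {V : Type*} {σ : ℕ → V → V → Prop} {i : ℕ}
    (h : σ (i + 1) = fun _ _ => False) (p : V) : LG σ (i + 1) p = LG σ i p := by
  simp [LG, h]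

/-- The time shift of link events that leaves room for a state inserted after position `k`. -/
def shiftAfter {V : Type*} (k : ℕ) (x : V × V × ℕ) : V × V × ℕ :=
  if x.2.2 ≤ k then x else (x.1, x.2.1, x.2.2 + 1)

theorem shiftAfter_image_LG_self {V : Type*} (σ : ℕ → V → V → Prop) (k : ℕ) (p : V) :
    shiftAfter k '' LG σ k p = LG σ k p := by
  have h : Set.EqOn (shiftAfter k) id (LG σ k p) := fun x hx => if_pos (time_le_of_mem_LG hx)
  rw [h.image_eq, Set.image_id]

theorem shiftAfter_of_lt {V : Type*} {k t : ℕ} (h : k < t) (u v : V) :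
    shiftAfter k (u, v, t) = (u, v, t + 1) :=
  if_neg h.not_ge

theorem LG_insertNC_succ {V : Type*} (σ : ℕ → V → V → Prop) {k j : ℕ} (hj : k ≤ j) (p : V) :
    LG (insertNC σ k) (j + 1) p = shiftAfter k '' LG σ j p := by
  induction j, hj using Nat.le_induction generalizing p with
  | base =>
    rw [LG_succ_of_not_communicating (insertNC_succ_self σ k), shiftAfter_image_LG_self]
    exact LG_congr (fun t ht => insertNC_of_le σ ht) p
  | succ j hj ih =>
    have hlt : k < j + 1 := Nat.lt_succ_of_le hj
    rw [LG_succ _ (j + 1), LG_succ σ j, Set.image_union, ← ih, insertNC_succ_of_lt σ hlt]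
    congr 1
    ext x
    simp only [ih, Set.mem_ofPred_eq, Set.mem_image]
    constructor
    · rintro ⟨q, hq, ⟨y, hy, rfl⟩ | rfl⟩
      · exact ⟨y, ⟨q, hq, Or.inl hy⟩, rfl⟩
      · exact ⟨_, ⟨q, hq, Or.inr rfl⟩, shiftAfter_of_lt hlt q p⟩
    · rintro ⟨y, ⟨q, hq, hy | rfl⟩, rfl⟩
      · exact ⟨q, hq, Or.inl ⟨y, hy, rfl⟩⟩
      · exact ⟨q, hq, Or.inr (shiftAfter_of_lt hlt q p)⟩

/-- Inserting a non-communicating state after position `k` preserves local observation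
graphs: they are unchanged up to state `k`, and from state `k+1` on they are the image
of the old graphs under the time shift `φ` sending `(u,v,t)` to `(u,v,t)` for `t ≤ k`
and to `(u,v,t+1)` for `t > k`. -/
theorem LG_insertNC {V : Type*} [Fintype V] [Nonempty V]
    (σ : ℕ → V → V → Prop) (k : ℕ) (p : V) :
    (∀ i ≤ k, LG (insertNC σ k) i p = LG σ i p) ∧
    (∀ i : ℕ, k + 1 ≤ i →
      LG (insertNC σ k) i p =
        (fun x : V × V × ℕ =>
          if x.2.2 ≤ k then x else (x.1, x.2.1, x.2.2 + 1)) '' LG σ (i - 1) p) := by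
  refine ⟨fun i hi => LG_congr (fun t ht => insertNC_of_le σ (ht.trans hi)) p, ?_⟩
  rintro (_ | j) hj
  · omega
  · exact LG_insertNC_succ σ (Nat.le_of_succ_le_succ hj) p
end

section
/- Every knot is a full strongly connected component: let r : V → V → Prop be a directed graph on a type V, let K be a knot of r, and let v ∈ K. Then K = { w : Relation.ReflTransGen r v w ∧ Relation.ReflTransGen r w v }, i.e., K is exactly the set of vertices mutually reachable with v in r. -/
/-- A set with no incoming edges is closed under predecessors along directed paths. -/
theorem Relation.ReflTransGen.mem_of_no_edge_into {V : Type*} {r : V → V → Prop} {K : Set V}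
    (hin : ∀ u w, r u w → u ∉ K → w ∉ K) {u w : V} (h : Relation.ReflTransGen r u w)
    (hw : w ∈ K) : u ∈ K := by
  induction h using Relation.ReflTransGen.head_induction_on with
  | refl => exact hw
  | head hab _ ih => exact by_contra fun ha => hin _ _ hab ha ih

/-- A knot is a full strongly connected component: it is exactly the set of vertices
mutually reachable with any of its members. -/
theorem knot_eq_scc {V : Type*} (r : V → V → Prop) (K : Set V)
    (hK : IsKnot r K) (v : V) (hv : v ∈ K) :
    K = {w | Relation.ReflTransGen r v w ∧ Relation.ReflTransGen r w v} := by
  obtain ⟨-, hconn, hin⟩ := hK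
  ext w
  refine ⟨fun hw => ⟨?_, ?_⟩, fun hw => hw.2.mem_of_no_edge_into hin hv⟩
  · exact Relation.ReflTransGen.mono (fun _ _ h => h.1) _ _ (hconn v hv w hw)
  · exact Relation.ReflTransGen.mono (fun _ _ h => h.1) _ _ (hconn w hw v hv)
end
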